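/- Let (W,S) be a finite Coxeter system which is a direct product of irreducible finite Coxeter systems, each of whose Coxeter numbers is at least 3. Then every simple reflection s in S is small, i.e., s <= w_0 s in the Bruhat order, where w_0 is the longest element of W. -/

import Mathlib

/-- The Bruhat order on a Coxeter group: `x ≤ y` if and only if `x` is the product of
a subword of some reduced word for `y`. -/
def CoxeterSystem.bruhatLE {B W : Type*} [Group W] {M : CoxeterMatrix B}
    (cs : CoxeterSystem M W) (x y : W) : Prop :=
  ∃ ω : List B, cs.IsReduced ω ∧ cs.wordProd ω = y ∧
    ∃ ω' : List B, ω'.Sublist ω ∧ cs.wordProd ω' = x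

/-- Two indices lie in the same irreducible component of a Coxeter system iff they are
related by the equivalence closure of adjacency in the Coxeter diagram (distinct indices
`a`, `b` are adjacent iff `M a b ≠ 2`). -/
def CoxeterMatrix.SameComponent {B : Type*} (M : CoxeterMatrix B) (i j : B) : Prop :=
  Relation.EqvGen (fun a b => a ≠ b ∧ M a b ≠ 2) i j

open Polynomial.Chebyshev in
theorem Polynomial.Chebyshev.eval_S_two_mul_cos_mul_sin (n : ℤ) (θ : ℝ) :
    (S ℝ n).eval (2 * Real.cos θ) * Real.sin θ = Real.sin ((n + 1) * θ) := by
  rw [← U_real_cos, ← S_comp_two_mul_X]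
  simp

namespace CoxeterMatrix

variable {B : Type*} (M : CoxeterMatrix B)

/-- The simple coroot of index `i`, as a functional on the space with basis the simple roots:
it takes the value `-2 cos (π / M i j)` on the simple root `j`. With the convention `π / 0 = 0`,
the value is `-2` when `M i j = 0`, that is, when the order is infinite. -/
noncomputable def simpleCoroot (i : B) : Module.Dual ℝ (B →₀ ℝ) :=
  Finsupp.linearCombination ℝ fun j ↦ -2 * Real.cos (Real.pi / M i j)

theorem simpleCoroot_single (i j : B) :
    M.simpleCoroot i (Finsupp.single j 1) = -2 * Real.cos (Real.pi / M i j) := by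
  simp [simpleCoroot]

theorem simpleCoroot_single_self (i : B) : M.simpleCoroot i (Finsupp.single i 1) = 2 := by
  simp [simpleCoroot_single]

theorem simpleCoroot_single_ne_zero {i j : B} (hij : i ≠ j) (hM : M i j ≠ 2) :
    M.simpleCoroot i (Finsupp.single j 1) ≠ 0 := by
  rw [simpleCoroot_single]
  have h1 := M.off_diagonal i j hij
  obtain h0 | h3 : M i j = 0 ∨ 3 ≤ M i j := by change M i j ≠ 1 at h1; lia
  · simp [h0]
  · have h3' : (3 : ℝ) ≤ M i j := by exact_mod_cast h3
    have hlt : Real.pi / M i j < Real.pi / 2 :=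
      div_lt_div_of_pos_left Real.pi_pos (by norm_num) (by linarith)
    have hpos : 0 < Real.pi / M i j := div_pos Real.pi_pos (by linarith)
    have := Real.cos_pos_of_mem_Ioo ⟨by linarith [Real.pi_pos], hlt⟩
    simpa using this.ne'

/-- The reflection of the geometric representation attached to the index `i`. -/
noncomputable def simpleReflection (i : B) : (B →₀ ℝ) ≃ₗ[ℝ] (B →₀ ℝ) :=
  Module.reflection (M.simpleCoroot_single_self i)

theorem simpleReflection_apply (i : B) (v : B →₀ ℝ) :
    M.simpleReflection i v = v - M.simpleCoroot i v • Finsupp.single i 1 :=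
  Module.reflection_apply v (M.simpleCoroot_single_self i)

open Polynomial.Chebyshev in
theorem isLiftable_simpleReflection : M.IsLiftable M.simpleReflection := by
  intro i j
  by_cases hij : i = j
  · subst hij
    ext1 v
    rw [M.diagonal, pow_one]
    exact Module.involutive_reflection (M.simpleCoroot_single_self i) v
  obtain h0 | h2 | h3 : M i j = 0 ∨ M i j = 2 ∨ 3 ≤ M i j := by
    have h1 := M.off_diagonal i j hij
    change M i j ≠ 1 at h1
    lia
  · rw [h0, pow_zero]
  · have hij0 : M.simpleCoroot i (Finsupp.single j 1) = 0 := by simp [simpleCoroot_single, h2]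
    have hji0 : M.simpleCoroot j (Finsupp.single i 1) = 0 := by
      simp [simpleCoroot_single, M.symmetric j i, h2]
    ext1 v
    rw [h2, pow_two]
    simp only [LinearEquiv.mul_apply, simpleReflection_apply, map_sub, map_smul, hij0, hji0,
      simpleCoroot_single_self, LinearEquiv.coe_one, id_eq]
    module
  · set m := M i j
    set θ : ℝ := 2 * (Real.pi / m)
    have hm : (3 : ℝ) ≤ m := by exact_mod_cast h3
    have hθ : (m : ℝ) * θ = 2 * Real.pi := by simp only [θ]; field_simp
    have hθ_pos : 0 < θ := by have := Real.pi_pos; positivity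
    have hθ_lt : θ < Real.pi := by nlinarith
    have hsin : Real.sin θ ≠ 0 := (Real.sin_pos_of_pos_of_lt_pi hθ_pos hθ_lt).ne'
    have ht : 2 * Real.cos θ = M.simpleCoroot i (Finsupp.single j 1) *
        M.simpleCoroot j (Finsupp.single i 1) - 2 := by
      rw [simpleCoroot_single, simpleCoroot_single, M.symmetric j i, Real.cos_two_mul]
      ring
    ext1 v
    have key := Module.reflection_mul_reflection_pow_apply (M.simpleCoroot_single_self i)
      (M.simpleCoroot_single_self j) m v (2 * Real.cos θ) ht
    refine key.trans ?_
    obtain ⟨k, hk | hk⟩ := Nat.even_or_odd' m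
    · have hS : (S ℝ (k - 1 : ℤ)).eval (2 * Real.cos θ) = 0 := by
        refine (mul_eq_zero.mp ?_).resolve_right hsin
        rw [eval_S_two_mul_cos_mul_sin, ← Real.sin_pi]
        congr 1
        rw [hk] at hθ
        push_cast at hθ ⊢
        linarith
      rw [show ((m : ℤ) - 2) / 2 = k - 1 by lia, show ((m : ℤ) - 1) / 2 = k - 1 by lia, hS]
      simp
    · have hS : (S ℝ (k : ℤ)).eval (2 * Real.cos θ) +
          (S ℝ (k - 1 : ℤ)).eval (2 * Real.cos θ) = 0 := by
        refine (mul_eq_zero.mp ?_).resolve_right hsin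
        rw [add_mul, eval_S_two_mul_cos_mul_sin, eval_S_two_mul_cos_mul_sin]
        rw [hk] at hθ
        push_cast at hθ ⊢
        rw [show ((k : ℝ) + 1) * θ = 2 * Real.pi - (k - 1 + 1) * θ by linarith,
          Real.sin_two_pi_sub]
        ring
      rw [show ((m : ℤ) - 2) / 2 = k - 1 by lia, show ((m : ℤ) - 1) / 2 = k by lia,
        show ((m : ℤ) - 3) / 2 = k - 1 by lia, show (m : ℤ) / 2 = k by lia, hS]
      simp

theorem SameComponent.eq_of_forall_eq_two {M : CoxeterMatrix B} {i j : B}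
    (h : M.SameComponent i j) (hi : ∀ k, i ≠ k → M i k = 2) : j = i := by
  suffices ∀ x y, M.SameComponent x y → (x = i ↔ y = i) from (this i j h).mp rfl
  intro x y hxy
  induction hxy with
  | rel x y hxy =>
    constructor
    · rintro rfl
      exact absurd (hi y hxy.1) hxy.2
    · rintro rfl
      exact absurd (M.symmetric x y ▸ hi x hxy.1.symm) hxy.2
  | refl x => rfl
  | symm x y _ ih => exact ih.symm
  | trans x y z _ _ ih₁ ih₂ => exact ih₁.trans ih₂

end CoxeterMatrix

namespace CoxeterSystem

variable {B W : Type*} [Group W] {M : CoxeterMatrix B} (cs : CoxeterSystem M W)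

/-- The geometric representation of a Coxeter group. -/
noncomputable def geometricRep : W →* ((B →₀ ℝ) ≃ₗ[ℝ] (B →₀ ℝ)) :=
  cs.lift ⟨M.simpleReflection, M.isLiftable_simpleReflection⟩

theorem geometricRep_simple (i : B) : cs.geometricRep (cs.simple i) = M.simpleReflection i :=
  cs.lift_apply_simple M.isLiftable_simpleReflection i

/-- A product of simple reflections other than `i` preserves the coordinate along the simple
root `i`. -/
theorem geometricRep_wordProd_apply_of_notMem {i : B} {ω : List B} (hi : i ∉ ω) (v : B →₀ ℝ) :
    cs.geometricRep (cs.wordProd ω) v i = v i := by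
  induction ω with
  | nil => simp
  | cons k ω ih =>
    rw [List.mem_cons, not_or] at hi
    rw [wordProd_cons, map_mul, LinearEquiv.mul_apply, geometricRep_simple,
      M.simpleReflection_apply, Finsupp.sub_apply, ih hi.2, Finsupp.smul_apply,
      Finsupp.single_eq_of_ne hi.1]
    simp

theorem simple_ne_wordProd_of_notMem {i : B} {ω : List B} (hi : i ∉ ω) :
    cs.simple i ≠ cs.wordProd ω := by
  intro h
  have := cs.geometricRep_wordProd_apply_of_notMem hi (Finsupp.single i 1)
  rw [← h, geometricRep_simple, M.simpleReflection_apply, M.simpleCoroot_single_self] at this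
  norm_num at this

theorem simple_mul_simple_mul_simple_ne_wordProd_of_notMem {i j : B} (hij : i ≠ j)
    (hM : M i j ≠ 2) {ω : List B} (hi : i ∉ ω) :
    cs.simple i * cs.simple j * cs.simple i ≠ cs.wordProd ω := by
  intro h
  have := cs.geometricRep_wordProd_apply_of_notMem hi (Finsupp.single i 1)
  rw [← h] at this
  simp only [map_mul, geometricRep_simple, LinearEquiv.mul_apply, M.simpleReflection_apply,
    M.simpleCoroot_single_self, map_sub, map_smul] at this
  have hij' := M.simpleCoroot_single_ne_zero hij hM
  have hji' := M.simpleCoroot_single_ne_zero hij.symm (M.symmetric i j ▸ hM)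
  refine mul_ne_zero hij' hji' ?_
  simp [hij] at this
  linarith

open Classical in
/-- The action of a simple reflection on `W × ZMod 2` by conjugation on the first factor,
changing the sign in the second one exactly when the first one is that simple reflection. -/
noncomputable def signedConj (i : B) : Function.End (W × ZMod 2) := fun p ↦
  (cs.simple i * p.1 * cs.simple i, p.2 + if p.1 = cs.simple i then 1 else 0)

open Classical in
theorem signedConj_mul_pow_apply (i j : B) (k : ℕ) (t : W) (ε : ZMod 2) :
    ((cs.signedConj i * cs.signedConj j) ^ k) (t, ε) =
      ((cs.simple i * cs.simple j) ^ k * t * ((cs.simple i * cs.simple j) ^ k)⁻¹,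
        ε + ∑ n ∈ Finset.range (2 * k),
          if t = cs.simple j * (cs.simple i * cs.simple j) ^ n then 1 else 0) := by
  induction k with
  | zero => simp [Function.End.one_def]
  | succ k ih =>
    rw [pow_succ']
    change cs.signedConj i (cs.signedConj j (((cs.signedConj i * cs.signedConj j) ^ k) (t, ε))) = _
    rw [ih, show 2 * (k + 1) = 2 * k + 1 + 1 by ring, Finset.sum_range_succ,
      Finset.sum_range_succ]
    set r := cs.simple i * cs.simple j with hr
    have hjr : cs.simple j * r ^ k = (r ^ k)⁻¹ * cs.simple j := by
      have h : SemiconjBy (cs.simple j) r r⁻¹ := by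
        simp [SemiconjBy, hr, mul_assoc]
      simpa [SemiconjBy] using h.pow_right k
    have h1 : r ^ k * t * (r ^ k)⁻¹ = cs.simple j ↔ t = cs.simple j * r ^ (2 * k) := by
      rw [two_mul, pow_add, ← mul_assoc, hjr, mul_inv_eq_iff_eq_mul, mul_assoc,
        eq_inv_mul_iff_mul_eq]
    have h2 : cs.simple j * (r ^ k * t * (r ^ k)⁻¹) * cs.simple j = cs.simple i ↔
        t = cs.simple j * r ^ (2 * k + 1) := by
      have : cs.simple j * r ^ (2 * k + 1) = (r ^ k)⁻¹ * (cs.simple j * r) * r ^ k := by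
        rw [show 2 * k + 1 = k + (1 + k) by ring, pow_add, pow_add, ← mul_assoc, hjr, pow_one]
        simp only [mul_assoc]
      rw [this, ← eq_mul_inv_iff_mul_eq, cs.inv_simple, ← eq_inv_mul_iff_mul_eq, cs.inv_simple,
        mul_inv_eq_iff_eq_mul, ← eq_inv_mul_iff_mul_eq, hr]
      simp only [mul_assoc]
    simp only [signedConj, h1, h2, Prod.mk.injEq]
    constructor
    · rw [pow_succ' r k, mul_inv_rev]
      simp [hr, mul_assoc]
    · ring

theorem isLiftable_signedConj : M.IsLiftable cs.signedConj := by
  classical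
  intro i j
  funext ⟨t, ε⟩
  rw [signedConj_mul_pow_apply, two_mul, Finset.sum_range_add]
  simp only [pow_add, simple_mul_simple_pow, one_mul, mul_one, inv_one, CharTwo.add_self_eq_zero]
  simp [Function.End.one_def]

open Classical in
theorem lift_signedConj_wordProd (ω : List B) (t : W) (ε : ZMod 2) :
    cs.lift ⟨cs.signedConj, cs.isLiftable_signedConj⟩ (cs.wordProd ω) (t, ε) =
      (cs.wordProd ω * t * (cs.wordProd ω)⁻¹, ε + ((cs.rightInvSeq ω).count t : ZMod 2)) := by
  induction ω with
  | nil => simp [Function.End.one_def]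
  | cons i ω ih =>
    rw [wordProd_cons, map_mul]
    change cs.lift ⟨cs.signedConj, cs.isLiftable_signedConj⟩ (cs.simple i)
      (cs.lift ⟨cs.signedConj, cs.isLiftable_signedConj⟩ (cs.wordProd ω) (t, ε)) = _
    rw [ih, lift_apply_simple, rightInvSeq, List.count_cons]
    have h : cs.wordProd ω * t * (cs.wordProd ω)⁻¹ = cs.simple i ↔
        (cs.wordProd ω)⁻¹ * cs.simple i * cs.wordProd ω = t := by
      rw [mul_inv_eq_iff_eq_mul, mul_assoc, inv_mul_eq_iff_eq_mul, eq_comm]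
    simp only [signedConj, h]
    simp [mul_assoc, add_assoc]

open Classical in
theorem count_rightInvSeq_eq_of_wordProd_eq {ω ω' : List B}
    (h : cs.wordProd ω = cs.wordProd ω') (t : W) :
    ((cs.rightInvSeq ω).count t : ZMod 2) = (cs.rightInvSeq ω').count t := by
  have h₁ := cs.lift_signedConj_wordProd ω t 0
  rw [h, lift_signedConj_wordProd] at h₁
  simpa using (congrArg Prod.snd h₁).symm

/-- The exchange property for a right descent. -/
theorem simple_mem_rightInvSeq_of_isRightDescent {ω : List B} {j : B}
    (h : cs.IsRightDescent (cs.wordProd ω) j) : cs.simple j ∈ cs.rightInvSeq ω := by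
  classical
  by_contra hmem
  obtain ⟨τ, hτ, hτω⟩ := cs.exists_isReduced (cs.wordProd ω * cs.simple j)
  have hτj : cs.simple j ∈ cs.rightInvSeq τ := by
    have hprod : cs.wordProd (ω.concat j) = cs.wordProd τ := by rw [wordProd_concat, hτω]
    have hcount := cs.count_rightInvSeq_eq_of_wordProd_eq hprod (cs.simple j)
    rw [rightInvSeq_concat] at hcount
    by_contra hτj
    have hconj : cs.simple j ∉ (cs.rightInvSeq ω).map (MulAut.conj (cs.simple j)) := by
      intro hmap
      obtain ⟨t, ht, htj⟩ := List.mem_map.mp hmap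
      have : t = cs.simple j := by
        rw [MulAut.conj_apply, mul_inv_eq_iff_eq_mul, mul_right_inj] at htj
        exact htj
      exact hmem (this ▸ ht)
    simp [List.count_eq_zero_of_not_mem hτj, List.count_append,
      List.count_eq_zero_of_not_mem hconj] at hcount
  have := (cs.isRightInversion_of_mem_rightInvSeq hτ hτj).2
  rw [← hτω, simple_mul_simple_cancel_right] at this
  exact lt_asymm this h

/-- The elements of the right inversion sequence of a word avoiding `i` are products of words
avoiding `i`. -/
theorem exists_wordProd_eq_of_mem_rightInvSeq {i : B} {ω : List B} (hi : i ∉ ω) {t : W}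
    (ht : t ∈ cs.rightInvSeq ω) : ∃ τ : List B, i ∉ τ ∧ cs.wordProd τ = t := by
  induction ω with
  | nil => simp at ht
  | cons k ω ih =>
    rw [rightInvSeq, List.mem_cons] at ht
    rw [List.mem_cons, not_or] at hi
    obtain rfl | ht := ht
    · exact ⟨ω.reverse ++ k :: ω, by simp [hi], by
        simp [wordProd_append, wordProd_cons, mul_assoc]⟩
    · exact ih hi.2 ht

end CoxeterSystem

/-- Let `(W, S)` be a finite Coxeter system, each of whose irreducible
factors has Coxeter number at least `3` (the Coxeter number of an irreducible component is
the order of the product of all the simple reflections of that component, taken in any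
order).  Then every simple reflection `s` is small, i.e. `s ≤ w₀ s` in the Bruhat order,
where `w₀` is the longest element. -/
theorem simple_is_small {B W : Type*} [Group W] [Finite W] [Finite B]
    {M : CoxeterMatrix B} (cs : CoxeterSystem M W)
    (hCox : ∀ i : B, ∀ l : List B, l.Nodup →
      (∀ j : B, j ∈ l ↔ M.SameComponent i j) → 3 ≤ orderOf (cs.wordProd l))
    (w₀ : W) (hw₀max : ∀ w : W, cs.length w ≤ cs.length w₀)
    (hw₀uniq : ∀ w : W, cs.length w = cs.length w₀ → w = w₀) :
    ∀ i : B, cs.bruhatLE (cs.simple i) (w₀ * cs.simple i) := by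
  intro i
  obtain ⟨j, hij, hM⟩ : ∃ j, i ≠ j ∧ M i j ≠ 2 := by
    by_contra! h
    have h3 := hCox i [i] (List.nodup_singleton i) fun j ↦
      ⟨fun hj ↦ (List.mem_singleton.mp hj) ▸ Relation.EqvGen.refl _,
        fun hj ↦ List.mem_singleton.mpr (hj.eq_of_forall_eq_two h)⟩
    have h2 := orderOf_le_of_pow_eq_one two_pos (cs.simple_sq i)
    rw [cs.wordProd_singleton] at h3
    lia
  obtain ⟨ω, hω, hprod⟩ := cs.exists_isReduced (w₀ * cs.simple i)
  refine ⟨ω, hω, hprod.symm, [i], ?_, cs.wordProd_singleton i⟩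
  rw [List.singleton_sublist]
  by_contra hi
  have hw₀ : cs.wordProd (ω.concat i) = w₀ := by
    rw [cs.wordProd_concat, ← hprod, cs.simple_mul_simple_cancel_right]
  have hdesc : cs.IsRightDescent (cs.wordProd (ω.concat i)) j := by
    rw [hw₀]
    exact (hw₀max _).lt_of_ne (cs.length_mul_simple_ne w₀ j)
  have hmem := cs.simple_mem_rightInvSeq_of_isRightDescent hdesc
  rw [cs.rightInvSeq_concat, List.concat_eq_append, List.mem_append, List.mem_singleton,
    List.mem_map] at hmem
  obtain ⟨t, ht, htj⟩ | hji := hmem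
  · obtain ⟨τ, hτ, rfl⟩ := cs.exists_wordProd_eq_of_mem_rightInvSeq hi ht
    refine cs.simple_mul_simple_mul_simple_ne_wordProd_of_notMem hij hM hτ ?_
    rw [← htj]
    simp [mul_assoc]
  · refine cs.simple_ne_wordProd_of_notMem (ω := [j]) (by simpa using hij) ?_
    rw [cs.wordProd_singleton, hji]
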